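/- arXiv:1912.05342 — 11 statements merged into one kernel-verified Lean document; each statement's English description precedes it below -/
import Mathlib

section
/- Let u : ℝ × ℝ → ℝ be a smooth solution of the fifth-order modified KdV equation. For each k ∈ ℂ define the 2×2 complex matrices σ₃ = [[1,0],[0,−1]], U = [[0,u],[u,0]], X = i k σ₃ + U, and T = −16 i k⁵ σ₃ + V, where V = −8 i k³ U² σ₃ + 2 i k (2 U U_{xx} − U_x² − 3 U⁴) σ₃ − 16 k⁴ U + 8 i k³ σ₃ U_x + k² (4 U_{xx} − 8 U³) + i k σ₃ (12 U² U_x − 2 U_{xxx}) − 6 U⁵ + 10 U² U_{xx} + 10 U U_x² − U_{xxxx}, with subscripts x denoting entrywise partial derivatives in x. Then the zero-curvature (compatibility) equation ∂_t X − ∂_x T + X T − T X = 0 holds identically for all (x,t) ∈ ℝ² and all k ∈ ℂ. -/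
open Matrix

/-- Partial derivative of order `n` in the first (spatial) variable. -/
noncomputable def pdx (u : ℝ × ℝ → ℝ) (n : ℕ) (p : ℝ × ℝ) : ℝ :=
  iteratedDeriv n (fun x => u (x, p.2)) p.1

/-- Partial derivative in the second (time) variable. -/
noncomputable def pdt (u : ℝ × ℝ → ℝ) (p : ℝ × ℝ) : ℝ :=
  deriv (fun τ => u (p.1, τ)) p.2

/-- `u` solves the fifth-order modified KdV equation at every point. -/
def mKdV5 (u : ℝ × ℝ → ℝ) : Prop :=
  ∀ p : ℝ × ℝ,
    pdt u p + pdx u 5 p + 30 * u p ^ 4 * pdx u 1 p - 10 * u p ^ 2 * pdx u 3 p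
      - 10 * (pdx u 1 p) ^ 3 - 40 * u p * pdx u 1 p * pdx u 2 p = 0

/-- The third Pauli matrix `σ₃`. -/
def sigma3 : Matrix (Fin 2) (Fin 2) ℂ := !![1, 0; 0, -1]

/-- The off-diagonal real symmetric matrix `[[0,a],[a,0]]`, viewed over `ℂ`. -/
def Uof (a : ℝ) : Matrix (Fin 2) (Fin 2) ℂ := !![0, (a : ℂ); (a : ℂ), 0]

/-- The `x`-part `X = i k σ₃ + U` of the Lax pair. -/
noncomputable def laxX (u : ℝ × ℝ → ℝ) (k : ℂ) (p : ℝ × ℝ) : Matrix (Fin 2) (Fin 2) ℂ :=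
  (Complex.I * k) • sigma3 + Uof (u p)

/-- The matrix `V` appearing in the `t`-part of the Lax pair:
`V = −8ik³U²σ₃ + 2ik(2UU_{xx} − U_x² − 3U⁴)σ₃ − 16k⁴U + 8ik³σ₃U_x + k²(4U_{xx} − 8U³)
  + ikσ₃(12U²U_x − 2U_{xxx}) − 6U⁵ + 10U²U_{xx} + 10UU_x² − U_{xxxx}`. -/
noncomputable def laxV (u : ℝ × ℝ → ℝ) (k : ℂ) (p : ℝ × ℝ) : Matrix (Fin 2) (Fin 2) ℂ :=
  (-8 * Complex.I * k ^ 3) • (Uof (u p) ^ 2 * sigma3)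
    + (2 * Complex.I * k) •
        (((2 : ℂ) • (Uof (u p) * Uof (pdx u 2 p)) - Uof (pdx u 1 p) ^ 2
            - (3 : ℂ) • Uof (u p) ^ 4) * sigma3)
    + (-16 * k ^ 4) • Uof (u p)
    + (8 * Complex.I * k ^ 3) • (sigma3 * Uof (pdx u 1 p))
    + k ^ 2 • ((4 : ℂ) • Uof (pdx u 2 p) - (8 : ℂ) • Uof (u p) ^ 3)
    + (Complex.I * k) •
        (sigma3 * ((12 : ℂ) • (Uof (u p) ^ 2 * Uof (pdx u 1 p)) - (2 : ℂ) • Uof (pdx u 3 p)))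
    - (6 : ℂ) • Uof (u p) ^ 5
    + (10 : ℂ) • (Uof (u p) ^ 2 * Uof (pdx u 2 p))
    + (10 : ℂ) • (Uof (u p) * Uof (pdx u 1 p) ^ 2)
    - Uof (pdx u 4 p)

/-- The `t`-part `T = −16 i k⁵ σ₃ + V` of the Lax pair. -/
noncomputable def laxT (u : ℝ × ℝ → ℝ) (k : ℂ) (p : ℝ × ℝ) : Matrix (Fin 2) (Fin 2) ℂ :=
  (-16 * Complex.I * k ^ 5) • sigma3 + laxV u k p

/-- Entrywise partial derivative in `t` of a matrix-valued function on `ℝ × ℝ`. -/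
noncomputable def matDt (F : ℝ × ℝ → Matrix (Fin 2) (Fin 2) ℂ) (p : ℝ × ℝ) :
    Matrix (Fin 2) (Fin 2) ℂ :=
  Matrix.of fun i j => deriv (fun τ => F (p.1, τ) i j) p.2

/-- Entrywise partial derivative in `x` of a matrix-valued function on `ℝ × ℝ`. -/
noncomputable def matDx (F : ℝ × ℝ → Matrix (Fin 2) (Fin 2) ℂ) (p : ℝ × ℝ) :
    Matrix (Fin 2) (Fin 2) ℂ :=
  Matrix.of fun i j => deriv (fun x => F (x, p.2) i j) p.1

lemma laxX_eq (u : ℝ × ℝ → ℝ) (k : ℂ) (p : ℝ × ℝ) :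
    laxX u k p = !![Complex.I * k, (u p : ℂ); (u p : ℂ), -(Complex.I * k)] := by
  ext i j
  fin_cases i <;> fin_cases j <;> simp [laxX, sigma3, Uof]

noncomputable def tA (k a b c : ℂ) : ℂ :=
  -16 * Complex.I * k ^ 5 - 8 * Complex.I * k ^ 3 * a ^ 2
    + 2 * Complex.I * k * (2 * a * c - b ^ 2 - 3 * a ^ 4)

noncomputable def tB (k a b c d e : ℂ) : ℂ :=
  -16 * k ^ 4 * a + k ^ 2 * (4 * c - 8 * a ^ 3) - 6 * a ^ 5 + 10 * a ^ 2 * c + 10 * a * b ^ 2 - e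
    + (8 * Complex.I * k ^ 3 * b + Complex.I * k * (12 * a ^ 2 * b - 2 * d))

noncomputable def tC (k a b c d e : ℂ) : ℂ :=
  -16 * k ^ 4 * a + k ^ 2 * (4 * c - 8 * a ^ 3) - 6 * a ^ 5 + 10 * a ^ 2 * c + 10 * a * b ^ 2 - e
    - (8 * Complex.I * k ^ 3 * b + Complex.I * k * (12 * a ^ 2 * b - 2 * d))

lemma laxT_eq (u : ℝ × ℝ → ℝ) (k : ℂ) (p : ℝ × ℝ) :
    laxT u k p = !![tA k (u p) (pdx u 1 p) (pdx u 2 p),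
      tB k (u p) (pdx u 1 p) (pdx u 2 p) (pdx u 3 p) (pdx u 4 p);
      tC k (u p) (pdx u 1 p) (pdx u 2 p) (pdx u 3 p) (pdx u 4 p),
      -tA k (u p) (pdx u 1 p) (pdx u 2 p)] := by
  ext i j
  fin_cases i <;> fin_cases j <;>
    simp [laxT, laxV, sigma3, Uof, pow_succ, tA, tB, tC, Matrix.mul_apply, Fin.sum_univ_two] <;>
    ring

lemma hasDerivAt_pdx (u : ℝ × ℝ → ℝ) (hu : ContDiff ℝ (⊤ : ℕ∞) u) (n : ℕ) (p : ℝ × ℝ) :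
    HasDerivAt (fun x => ((pdx u n (x, p.2) : ℝ) : ℂ)) (pdx u (n + 1) p : ℂ) p.1 := by
  have h : ContDiff ℝ (⊤ : ℕ∞) (fun x => u (x, p.2)) :=
    hu.comp (contDiff_id.prodMk contDiff_const)
  have h2 : Differentiable ℝ (iteratedDeriv n (fun x => u (x, p.2))) :=
    h.differentiable_iteratedDeriv n (by exact_mod_cast WithTop.coe_lt_top n)
  have h3 := (h2 p.1).hasDerivAt
  rw [← iteratedDeriv_succ] at h3
  exact h3.ofReal_comp

lemma hasDerivAt_pdt (u : ℝ × ℝ → ℝ) (hu : ContDiff ℝ (⊤ : ℕ∞) u) (p : ℝ × ℝ) :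
    HasDerivAt (fun t => ((u (p.1, t) : ℝ) : ℂ)) (pdt u p : ℂ) p.2 := by
  have h : ContDiff ℝ (⊤ : ℕ∞) (fun t => u (p.1, t)) :=
    hu.comp (contDiff_const.prodMk contDiff_id)
  exact ((h.differentiable (by simp)) p.2).hasDerivAt.ofReal_comp

/-- If `u` is a smooth solution of the fifth-order modified KdV equation, then the
zero-curvature (compatibility) equation `∂_t X − ∂_x T + X T − T X = 0` holds identically
for all `(x,t) ∈ ℝ²` and all `k ∈ ℂ`. -/
theorem mKdV5_zero_curvature (u : ℝ × ℝ → ℝ) (hu : ContDiff ℝ (⊤ : ℕ∞) u) (hsol : mKdV5 u) :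
    ∀ (p : ℝ × ℝ) (k : ℂ),
      matDt (laxX u k) p - matDx (laxT u k) p
        + laxX u k p * laxT u k p - laxT u k p * laxX u k p = 0 := by
  intro p k
  have h0 : HasDerivAt (fun x => ((u (x, p.2) : ℝ) : ℂ)) (pdx u 1 p : ℂ) p.1 := by
    simpa [pdx] using hasDerivAt_pdx u hu 0 p
  have h1 := hasDerivAt_pdx u hu 1 p
  have h2 := hasDerivAt_pdx u hu 2 p
  have h3 := hasDerivAt_pdx u hu 3 p
  have h4 := hasDerivAt_pdx u hu 4 p
  have ht := hasDerivAt_pdt u hu p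
  norm_num only at h1 h2 h3 h4
  have hs : (pdt u p : ℂ) = -(pdx u 5 p + 30 * u p ^ 4 * pdx u 1 p - 10 * u p ^ 2 * pdx u 3 p
      - 10 * (pdx u 1 p) ^ 3 - 40 * u p * pdx u 1 p * pdx u 2 p) := by
    have := hsol p
    have h : pdt u p = -(pdx u 5 p + 30 * u p ^ 4 * pdx u 1 p - 10 * u p ^ 2 * pdx u 3 p
      - 10 * (pdx u 1 p) ^ 3 - 40 * u p * pdx u 1 p * pdx u 2 p) := by linarith
    rw [h]; push_cast; ring
  have dA := (((h0.pow 2).const_mul (8 * Complex.I * k ^ 3)).const_sub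
    (-16 * Complex.I * k ^ 5)).add
    (((((h0.const_mul 2).mul h2).sub (h1.pow 2)).sub ((h0.pow 4).const_mul 3)).const_mul
      (2 * Complex.I * k))
  have dP := (((((h0.const_mul (-16 * k ^ 4)).add
    (((h2.const_mul 4).sub ((h0.pow 3).const_mul 8)).const_mul (k ^ 2))).sub
    ((h0.pow 5).const_mul 6)).add (((h0.pow 2).const_mul 10).mul h2)).add
    ((h0.const_mul 10).mul (h1.pow 2))).sub h4
  have dQ := (h1.const_mul (8 * Complex.I * k ^ 3)).add
    (((((h0.pow 2).const_mul 12).mul h1).sub (h3.const_mul 2)).const_mul (Complex.I * k))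
  have eA : deriv (fun x => tA k (u (x, p.2)) (pdx u 1 (x, p.2)) (pdx u 2 (x, p.2))) p.1 = _ :=
    dA.deriv
  have eB : deriv (fun x => tB k (u (x, p.2)) (pdx u 1 (x, p.2)) (pdx u 2 (x, p.2))
    (pdx u 3 (x, p.2)) (pdx u 4 (x, p.2))) p.1 = _ := (dP.add dQ).deriv
  have eC : deriv (fun x => tC k (u (x, p.2)) (pdx u 1 (x, p.2)) (pdx u 2 (x, p.2))
    (pdx u 3 (x, p.2)) (pdx u 4 (x, p.2))) p.1 = _ := (dP.sub dQ).deriv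
  have eT := ht.deriv
  have hI : Complex.I ^ 2 = -1 := Complex.I_sq
  have hx : matDt (laxX u k) p = !![0, (pdt u p : ℂ); (pdt u p : ℂ), 0] := by
    ext i j
    fin_cases i <;> fin_cases j <;> simp [matDt, laxX_eq, eT]
  have hT : matDx (laxT u k) p = !![deriv (fun x => tA k (u (x, p.2)) (pdx u 1 (x, p.2)) (pdx u 2 (x, p.2))) p.1,
      deriv (fun x => tB k (u (x, p.2)) (pdx u 1 (x, p.2)) (pdx u 2 (x, p.2))
        (pdx u 3 (x, p.2)) (pdx u 4 (x, p.2))) p.1;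
      deriv (fun x => tC k (u (x, p.2)) (pdx u 1 (x, p.2)) (pdx u 2 (x, p.2))
        (pdx u 3 (x, p.2)) (pdx u 4 (x, p.2))) p.1,
      -deriv (fun x => tA k (u (x, p.2)) (pdx u 1 (x, p.2)) (pdx u 2 (x, p.2))) p.1] := by
    ext i j
    fin_cases i <;> fin_cases j <;> simp [matDx, laxT_eq]
  rw [hx, hT, laxX_eq, laxT_eq, hs, eA, eB, eC]
  clear hx hT hs eA eB eC eT dA dP dQ h0 h1 h2 h3 h4 ht hsol
  ext i j
  fin_cases i <;> fin_cases j <;>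
    simp [tA, tB, tC, Matrix.mul_apply, Fin.sum_univ_two] <;> ring_nf <;> simp [hI] <;> ring
end

section
/- Let u : ℝ → ℝ be a Schwartz function. Then ∫_ℝ ( −2 ∂_x² u(x) + 4 u(x)³ ) · ( −∂_x⁵ u(x) − 6 ∂_x(u⁵)(x) + 5 ∂_x( u ∂_x²(u²) )(x) ) dx = 0. Consequently, for smooth decaying solutions of the fifth-order modified KdV equation the energy E(u) = ∫_ℝ (∂_x u)² + u⁴ dx is conserved in time. -/
open Filter Topology MeasureTheory in
theorem mKdV5_c0_aux (f : Fin 6 → SchwartzMap ℝ ℝ) (P : (Fin 6 → ℝ) → ℝ) (hP : Continuous P)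
    (h0 : P 0 = 0) : Tendsto (fun x => P (fun i => f i x)) (cocompact ℝ) (𝓝 0) := by
  have h1 : Tendsto (fun x => (fun i => f i x : Fin 6 → ℝ)) (cocompact ℝ) (𝓝 0) := by
    rw [tendsto_pi_nhds]
    intro i
    exact (f i).toZeroAtInfty.zero_at_infty'
  have h2 := (hP.tendsto 0).comp h1
  rw [h0] at h2
  exact h2

open Filter Topology MeasureTheory in
theorem mKdV5_bdd_aux (f : Fin 6 → SchwartzMap ℝ ℝ) (P : (Fin 6 → ℝ) → ℝ) (hP : Continuous P)
    (h0 : P 0 = 0) (g : ℝ → ℝ) (hg : Integrable g) :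
    Integrable (fun x => g x * P (fun i => f i x)) := by
  have hc : Continuous (fun x => P (fun i => f i x)) :=
    hP.comp (continuous_pi fun i => (f i).continuous)
  let F : ZeroAtInftyContinuousMap ℝ ℝ := ⟨⟨_, hc⟩, mKdV5_c0_aux f P hP h0⟩
  refine hg.mul_bdd (c := ‖F.toBCF‖) hc.aestronglyMeasurable (ae_of_all _ fun x => ?_)
  exact F.toBCF.norm_coe_le_norm x

open Filter Topology MeasureTheory in
/-- For Schwartz `u`, `∫ (−2∂_x²u + 4u³) · (−∂_x⁵u − 6∂_x(u⁵) + 5∂_x(u ∂_x²(u²))) dx = 0`;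
this is the identity underlying conservation of the energy `E(u) = ∫ (∂_x u)² + u⁴ dx` for
smooth decaying solutions of the fifth-order modified KdV equation. -/
theorem mKdV5_energy_identity (u : SchwartzMap ℝ ℝ) :
    ∫ x : ℝ, (-2 * iteratedDeriv 2 (⇑u) x + 4 * u x ^ 3) *
        (-iteratedDeriv 5 (⇑u) x - 6 * deriv (fun y => u y ^ 5) x
          + 5 * deriv (fun y => u y * iteratedDeriv 2 (fun z => u z ^ 2) y) x) = 0 := by
  let D := SchwartzMap.derivCLM ℝ ℝ
  have hD : ∀ (v : SchwartzMap ℝ ℝ) x, HasDerivAt v (D v x) x := fun v x => v.hasDerivAt x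
  have hD' : ∀ v : SchwartzMap ℝ ℝ, deriv (⇑v) = ⇑(D v) := fun v => funext fun x => (hD v x).deriv
  obtain ⟨b, hb⟩ : ∃ b, b = D u := ⟨_, rfl⟩
  obtain ⟨c, hc⟩ : ∃ c, c = D b := ⟨_, rfl⟩
  obtain ⟨d, hd⟩ : ∃ d, d = D c := ⟨_, rfl⟩
  obtain ⟨e, he⟩ : ∃ e, e = D d := ⟨_, rfl⟩
  obtain ⟨f, hf⟩ : ∃ f, f = D e := ⟨_, rfl⟩
  have i2 : iteratedDeriv 2 (⇑u) = c := by
    simp only [iteratedDeriv_succ, iteratedDeriv_zero, hD', hb, hc]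
  have i5 : iteratedDeriv 5 (⇑u) = f := by
    simp only [iteratedDeriv_succ, iteratedDeriv_zero, hD', hb, hc, hd, he, hf]
  have ha1 : ∀ x, HasDerivAt u (b x) x := fun x => hb ▸ hD u x
  have hb1 : ∀ x, HasDerivAt b (c x) x := fun x => hc ▸ hD b x
  have hc1 : ∀ x, HasDerivAt c (d x) x := fun x => hd ▸ hD c x
  have hd1 : ∀ x, HasDerivAt d (e x) x := fun x => he ▸ hD d x
  have he1 : ∀ x, HasDerivAt e (f x) x := fun x => hf ▸ hD e x
  clear hb hc hd he hf
  have j1 : deriv (fun z => u z ^ 2) = fun z => 2 * u z * b z := by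
    funext x
    refine ((ha1 x).pow 2).deriv.trans ?_
    norm_num
  have j2 : iteratedDeriv 2 (fun z => u z ^ 2) = fun z => 2 * (b z * b z) + 2 * (u z * c z) := by
    simp only [iteratedDeriv_succ, iteratedDeriv_zero, j1]
    funext x
    refine (((ha1 x).const_mul 2).mul (hb1 x)).deriv.trans ?_
    ring
  have j3 : ∀ x, deriv (fun y => u y * iteratedDeriv 2 (fun z => u z ^ 2) y) x
      = 2 * b x ^ 3 + 8 * u x * b x * c x + 2 * u x ^ 2 * d x := by
    intro x
    rw [j2]
    refine ((ha1 x).mul ((((hb1 x).mul (hb1 x)).const_mul 2).add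
      (((ha1 x).mul (hc1 x)).const_mul 2))).deriv.trans ?_
    simp only [Pi.add_apply, Pi.mul_apply]
    ring
  have j5 : ∀ x, deriv (fun y => u y ^ 5) x = 5 * u x ^ 4 * b x := by
    intro x
    refine ((ha1 x).pow 5).deriv.trans ?_
    norm_num
  simp only [i2, i5, j3, j5]
  let w : Fin 6 → SchwartzMap ℝ ℝ := ![u, b, c, d, e, f]
  have hI : Integrable (fun x => -2 * c x + 4 * u x ^ 3) := by
    refine (c.integrable.const_mul (-2)).add (Integrable.const_mul ?_ 4)
    have := mKdV5_bdd_aux w (fun p => p 0 ^ 2) (by fun_prop) (by simp) u u.integrable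
    refine this.congr (ae_of_all _ fun x => ?_)
    simp [w]; ring
  have hI2 := mKdV5_bdd_aux w (fun p => -p 5 - 6 * (5 * p 0 ^ 4 * p 1)
    + 5 * (2 * p 1 ^ 3 + 8 * p 0 * p 1 * p 2 + 2 * p 0 ^ 2 * p 3)) (by fun_prop) (by simp) _ hI
  have hT := mKdV5_c0_aux w (fun p => 2 * p 2 * p 4 - p 3 ^ 2 - 15 * p 0 ^ 8 + 40 * p 0 ^ 5 * p 2
    + 10 * p 0 ^ 4 * p 1 ^ 2 + p 1 ^ 4 - 16 * p 0 ^ 2 * p 2 ^ 2 - 4 * p 0 ^ 3 * p 4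
    + 12 * p 0 ^ 2 * p 1 * p 3 - 24 * p 0 * p 1 ^ 2 * p 2) (by fun_prop) (by simp)
  rw [← sub_self (0 : ℝ)]
  refine integral_of_hasDerivAt_of_tendsto (fun x => ?_) hI2
    (hT.mono_left atBot_le_cocompact) (hT.mono_left atTop_le_cocompact)
  have A := ha1 x
  have B := hb1 x
  have C := hc1 x
  have D := hd1 x
  have E := he1 x
  have key := ((((((((((C.const_mul 2).mul E).sub (D.pow 2)).sub ((A.pow 8).const_mul 15)).add
    (((A.pow 5).const_mul 40).mul C)).add (((A.pow 4).const_mul 10).mul (B.pow 2))).add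
    (B.pow 4)).sub (((A.pow 2).const_mul 16).mul (C.pow 2))).sub
    (((A.pow 3).const_mul 4).mul E)).add ((((A.pow 2).const_mul 12).mul B).mul D)).sub
    (((A.const_mul 24).mul (B.pow 2)).mul C)
  refine key.congr_deriv ?_
  simp [w]
  ring
end

section
/- Let u : ℝ → ℝ be a Schwartz function. Then the integration-by-parts identity ∫_ℝ ( 2 u(x)³ · ∂_x⁵ u(x) + 5 ∂_x² u(x) · ∂_x( u ∂_x²(u²) )(x) ) dx = 0 holds (this is the vanishing of the term T₃ in the paper's energy computation, and in Fourier variables it is the identity ∫_{ξ₁+ξ₂+ξ₃+ξ₄=0} (2ξ₁⁵ − 5ξ₁³(ξ₂+ξ₃)²) û(ξ₁)û(ξ₂)û(ξ₃)û(ξ₄) = 0). -/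
/-- Integration-by-parts identity (the vanishing of the term `T₃` in the energy computation
for the fifth-order modified KdV equation): for Schwartz `u`,
`∫ (2u³ ∂_x⁵u + 5 ∂_x²u · ∂_x(u ∂_x²(u²))) dx = 0`. -/
theorem mKdV5_T3_vanishes (u : SchwartzMap ℝ ℝ) :
    ∫ x : ℝ, (2 * u x ^ 3 * iteratedDeriv 5 (⇑u) x
        + 5 * iteratedDeriv 2 (⇑u) x *
            deriv (fun y => u y * iteratedDeriv 2 (fun z => u z ^ 2) y) x) = 0 := by
  obtain ⟨b, hb⟩ : ∃ b : SchwartzMap ℝ ℝ, ⇑b = deriv u := ⟨SchwartzMap.derivCLM ℝ ℝ u, rfl⟩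
  obtain ⟨c, hc⟩ : ∃ c : SchwartzMap ℝ ℝ, ⇑c = deriv b := ⟨SchwartzMap.derivCLM ℝ ℝ b, rfl⟩
  obtain ⟨d, hd⟩ : ∃ d : SchwartzMap ℝ ℝ, ⇑d = deriv c := ⟨SchwartzMap.derivCLM ℝ ℝ c, rfl⟩
  obtain ⟨e, he⟩ : ∃ e : SchwartzMap ℝ ℝ, ⇑e = deriv d := ⟨SchwartzMap.derivCLM ℝ ℝ d, rfl⟩
  obtain ⟨f, hf⟩ : ∃ f : SchwartzMap ℝ ℝ, ⇑f = deriv e := ⟨SchwartzMap.derivCLM ℝ ℝ e, rfl⟩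
  have Du : ∀ x, HasDerivAt u (b x) x := fun x => hb ▸ u.hasDerivAt x
  have Db : ∀ x, HasDerivAt b (c x) x := fun x => hc ▸ b.hasDerivAt x
  have Dc : ∀ x, HasDerivAt c (d x) x := fun x => hd ▸ c.hasDerivAt x
  have Dd : ∀ x, HasDerivAt d (e x) x := fun x => he ▸ d.hasDerivAt x
  have De : ∀ x, HasDerivAt e (f x) x := fun x => hf ▸ e.hasDerivAt x
  have h2 : iteratedDeriv 2 (⇑u) = c := by
    simp only [iteratedDeriv_succ, iteratedDeriv_zero, ← hb, ← hc]
  have h5 : iteratedDeriv 5 (⇑u) = f := by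
    simp only [iteratedDeriv_succ, iteratedDeriv_zero, ← hb, ← hc, ← hd, ← he, ← hf]
  have hs1 : deriv (fun z => u z ^ 2) = fun z => 2 * u z * b z := by
    funext z
    refine ((Du z).pow 2).deriv.trans ?_
    norm_num
  have hs2 : iteratedDeriv 2 (fun z => u z ^ 2) = fun z => 2 * b z * b z + 2 * u z * c z := by
    simp only [iteratedDeriv_succ, iteratedDeriv_zero]
    rw [hs1]
    funext z
    exact (((Du z).const_mul 2).mul (Db z)).deriv
  have hs3 : ∀ x, deriv (fun y => u y * iteratedDeriv 2 (fun z => u z ^ 2) y) x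
      = 2 * b x ^ 3 + 8 * u x * b x * c x + 2 * u x ^ 2 * d x := by
    intro x
    rw [hs2]
    refine ((Du x).mul ((((Db x).const_mul 2).mul (Db x)).add
      (((Du x).const_mul 2).mul (Dc x)))).deriv.trans ?_
    simp only [Pi.add_apply, Pi.mul_apply]
    ring
  let M : SchwartzMap ℝ ℝ → SchwartzMap ℝ ℝ → SchwartzMap ℝ ℝ := fun f g =>
    SchwartzMap.pairing (ContinuousLinearMap.mul ℝ ℝ) f g
  have hM : ∀ f g x, M f g x = f x * g x := fun f g x => rfl
  obtain ⟨F, hF⟩ : ∃ F : SchwartzMap ℝ ℝ, ∀ x, F x = 2 * (u x * (u x * (u x * e x)))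
      + (-6) * (u x * (u x * (b x * d x))) + 8 * (u x * (u x * (c x * c x)))
      + 12 * (u x * (b x * (b x * c x))) + (-1/2) * (b x * (b x * (b x * b x))) :=
    ⟨(2 : ℝ) • M u (M u (M u e)) + (-6 : ℝ) • M u (M u (M b d)) + (8 : ℝ) • M u (M u (M c c))
      + (12 : ℝ) • M u (M b (M b c)) + (-1/2 : ℝ) • M b (M b (M b b)), fun x => rfl⟩
  have hD : ∀ x, HasDerivAt F (2 * u x ^ 3 * iteratedDeriv 5 (⇑u) x
        + 5 * iteratedDeriv 2 (⇑u) x *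
            deriv (fun y => u y * iteratedDeriv 2 (fun z => u z ^ 2) y) x) x := by
    intro x
    rw [hs3, h2, h5, funext hF]
    have A := (((((Du x).mul ((Du x).mul ((Du x).mul (De x)))).const_mul 2).add
      (((Du x).mul ((Du x).mul ((Db x).mul (Dd x)))).const_mul (-6))).add
      (((Du x).mul ((Du x).mul ((Dc x).mul (Dc x)))).const_mul 8)).add
      (((Du x).mul ((Db x).mul ((Db x).mul (Dc x)))).const_mul 12) |>.add
      (((Db x).mul ((Db x).mul ((Db x).mul (Db x)))).const_mul (-1/2))
    refine A.congr_deriv ?_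
    simp only [Pi.mul_apply]
    ring
  refine MeasureTheory.integral_eq_zero_of_hasDerivAt_of_integrable hD ?_ F.integrable
  rw [← funext fun x => (hD x).deriv]
  exact (SchwartzMap.derivCLM ℝ ℝ F).integrable
end

section
/- Let u : ℝ → ℝ be a Schwartz function. Then the integration-by-parts identity ∫_ℝ ( 3 ∂_x² u(x) · ∂_x(u⁵)(x) + 5 u(x)³ · ∂_x( u ∂_x²(u²) )(x) ) dx = 0 holds (this is the vanishing of the term T₄ in the paper's energy computation, and in Fourier variables it is the identity ∫_{ξ₁+⋯+ξ₆=0} (ξ₁³ + 5ξ₁(ξ₂+ξ₃)²) û(ξ₁)⋯û(ξ₆) = 0). -/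
/-- Integration-by-parts identity (the vanishing of the term `T₄` in the energy computation
for the fifth-order modified KdV equation): for Schwartz `u`,
`∫ (3 ∂_x²u · ∂_x(u⁵) + 5u³ ∂_x(u ∂_x²(u²))) dx = 0`. -/
theorem mKdV5_T4_vanishes (u : SchwartzMap ℝ ℝ) :
    ∫ x : ℝ, (3 * iteratedDeriv 2 (⇑u) x * deriv (fun y => u y ^ 5) x
        + 5 * u x ^ 3 *
            deriv (fun y => u y * iteratedDeriv 2 (fun z => u z ^ 2) y) x) = 0 := by
  let b : SchwartzMap ℝ ℝ := SchwartzMap.derivCLM ℝ ℝ u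
  let c : SchwartzMap ℝ ℝ := SchwartzMap.derivCLM ℝ ℝ b
  let d : SchwartzMap ℝ ℝ := SchwartzMap.derivCLM ℝ ℝ c
  have hd : ∀ (f : SchwartzMap ℝ ℝ) (x : ℝ), HasDerivAt f (SchwartzMap.derivCLM ℝ ℝ f x) x := by
    intro f x
    rw [SchwartzMap.derivCLM_apply]
    exact f.differentiableAt.hasDerivAt
  have ha : ∀ x, HasDerivAt u (b x) x := hd u
  have hb : ∀ x, HasDerivAt b (c x) x := hd b
  have hc : ∀ x, HasDerivAt c (d x) x := hd c
  clear_value b c d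
  have e1 : deriv (⇑u) = b := funext fun x => (ha x).deriv
  have e2 : iteratedDeriv 2 (⇑u) = c := by
    rw [iteratedDeriv_succ, iteratedDeriv_one, e1]
    exact funext fun x => (hb x).deriv
  have e3 : iteratedDeriv 2 (fun z => u z ^ 2) = fun z => 2 * b z ^ 2 + 2 * u z * c z := by
    have : deriv (fun z => u z ^ 2) = fun z => 2 * u z * b z :=
      funext fun x => by refine (((ha x).pow 2).congr_deriv ?_).deriv; norm_num
    rw [iteratedDeriv_succ, iteratedDeriv_one, this]
    funext x
    refine ((((ha x).const_mul 2).mul (hb x)).congr_deriv ?_).deriv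
    ring
  have e4 : ∀ x, deriv (fun y => u y ^ 5) x = 5 * u x ^ 4 * b x := fun x => by
    refine (((ha x).pow 5).congr_deriv ?_).deriv; norm_num
  have e5 : ∀ x, deriv (fun y => u y * (2 * b y ^ 2 + 2 * u y * c y)) x
      = 2 * b x ^ 3 + 8 * u x * b x * c x + 2 * u x ^ 2 * d x := fun x => by
    refine (((ha x).mul ((((hb x).pow 2).const_mul 2).add
      (((ha x).const_mul 2).mul (hc x)))).congr_deriv ?_).deriv
    simp
    ring
  have ua := u.hasTemperateGrowth
  have ub := b.hasTemperateGrowth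
  have t1 : Function.HasTemperateGrowth (fun x => 10 * u x ^ 5) := by fun_prop
  have t2 : Function.HasTemperateGrowth (fun x => (5/2) * u x ^ 4 * b x) := by fun_prop
  let F : SchwartzMap ℝ ℝ := SchwartzMap.smulLeftCLM ℝ (fun x => 10 * u x ^ 5) c
    + SchwartzMap.smulLeftCLM ℝ (fun x => (5/2) * u x ^ 4 * b x) b
  have hF : ⇑F = fun x => 10 * u x ^ 5 * c x + (5/2) * u x ^ 4 * b x * b x := by
    funext x
    simp [F, SchwartzMap.smulLeftCLM_apply_apply t1, SchwartzMap.smulLeftCLM_apply_apply t2]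
  rw [e2, e3]
  simp only [e4, e5]
  rw [← MeasureTheory.integral_eq_zero_of_hasDerivAt_of_integrable (hd F)
    (SchwartzMap.integrable _) F.integrable]
  congr 1
  funext x
  refine HasDerivAt.unique ?_ (hd F x)
  rw [hF]
  refine ((((((ha x).pow 5).const_mul 10).mul (hc x))).add
    (((((ha x).pow 4).const_mul (5/2)).mul (hb x)).mul (hb x))).congr_deriv ?_
  simp
  ring
end

section
/- Let k₀ > 0 and let k ∈ ℂ ∖ [−k₀,k₀] (the segment [−k₀,k₀] viewed inside ℝ ⊂ ℂ). Then the Möbius image (k−k₀)/(k+k₀) lies in ℂ ∖ (−∞,0], and ∫_{−k₀}^{k₀} (s−k)^{−1} ds = Log( (k−k₀)/(k+k₀) ), where Log denotes the principal branch of the complex logarithm. (This identity underlies the factorization δ(k) = ((k−k₀)/(k+k₀))^{iν} e^{χ(k)} with ((k−k₀)/(k+k₀))^{iν} = exp(iν Log((k−k₀)/(k+k₀))).) -/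
open intervalIntegral

lemma mobius_mem_aux (k₀ : ℝ) (hk₀ : 0 < k₀) (k : ℂ)
    (hk : k ∉ Complex.ofReal '' Set.Icc (-k₀) k₀) (s : ℝ) (hs : s ∈ Set.Icc (-k₀) k₀) :
    (k - (s : ℂ)) / (k + (k₀ : ℂ)) ∈ Complex.slitPlane := by
  have hne : k + (k₀ : ℂ) ≠ 0 := by
    intro h
    apply hk
    refine ⟨-k₀, ⟨le_refl _, by linarith⟩, ?_⟩
    push_cast
    linear_combination -h
  by_contra hn
  rw [Complex.mem_slitPlane_iff] at hn
  push Not at hn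
  obtain ⟨h1, h2⟩ := hn
  set z := (k - (s : ℂ)) / (k + (k₀ : ℂ)) with hz
  obtain ⟨t, ht⟩ : ∃ t : ℝ, t = -z.re := ⟨_, rfl⟩
  have ht0 : 0 ≤ t := by linarith
  have hzt : z = -(t : ℂ) := by
    apply Complex.ext <;> simp [ht, h2]
  have hz2 : k - s = -(t : ℂ) * (k + k₀) := by
    rw [← hzt, hz, div_mul_cancel₀ _ hne]
  have hp : 0 < 1 + t := by linarith
  have hpc : (1 + (t : ℂ)) ≠ 0 := by exact_mod_cast hp.ne'
  apply hk
  refine ⟨(s - t * k₀) / (1 + t), ⟨?_, ?_⟩, ?_⟩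
  · rw [le_div_iff₀ hp]
    nlinarith [hs.1]
  · rw [div_le_iff₀ hp]
    nlinarith [hs.2, mul_nonneg ht0 hk₀.le]
  · push_cast
    rw [div_eq_iff hpc]
    linear_combination -hz2

/-- For `k₀ > 0` and `k ∈ ℂ ∖ [−k₀,k₀]`, the Möbius image `(k−k₀)/(k+k₀)` avoids the
nonpositive real axis, and `∫_{−k₀}^{k₀} (s−k)⁻¹ ds = Log((k−k₀)/(k+k₀))` with the
principal branch of the complex logarithm. -/
theorem integral_inv_sub_eq_log_mobius (k₀ : ℝ) (hk₀ : 0 < k₀) (k : ℂ)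
    (hk : k ∉ Complex.ofReal '' Set.Icc (-k₀) k₀) :
    (k - (k₀ : ℂ)) / (k + (k₀ : ℂ)) ∈ Complex.slitPlane ∧
    (∫ s in (-k₀)..k₀, ((s : ℂ) - k)⁻¹)
      = Complex.log ((k - (k₀ : ℂ)) / (k + (k₀ : ℂ))) := by
  have hne : ∀ s ∈ Set.Icc (-k₀) k₀, (s : ℂ) - k ≠ 0 := by
    intro s hs h
    exact hk ⟨s, hs, by linear_combination h⟩
  have hne0 : k + (k₀ : ℂ) ≠ 0 := by
    intro h
    apply hne (-k₀) ⟨le_refl _, by linarith⟩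
    push_cast
    linear_combination -h
  refine ⟨mobius_mem_aux k₀ hk₀ k hk k₀ ⟨by linarith, le_refl _⟩, ?_⟩
  have hI : Set.uIcc (-k₀) k₀ = Set.Icc (-k₀) k₀ := Set.uIcc_of_le (by linarith)
  rw [integral_eq_sub_of_hasDerivAt
    (f := fun s : ℝ => Complex.log ((k - (s : ℂ)) / (k + (k₀ : ℂ))))]
  · have : (k - ((-k₀ : ℝ) : ℂ)) / (k + (k₀ : ℂ)) = 1 := by
      push_cast
      rw [sub_neg_eq_add, div_self hne0]
    simp only [this, Complex.log_one, sub_zero]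
  · intro s hs
    rw [hI] at hs
    have h1 : HasDerivAt (fun s : ℝ => (k - (s : ℂ)) / (k + (k₀ : ℂ)))
        (-1 / (k + (k₀ : ℂ))) s :=
      ((Complex.ofRealCLM.hasDerivAt (x := s)).const_sub k).div_const _
    have h2 := h1.clog_real (mobius_mem_aux k₀ hk₀ k hk s hs)
    have h3 := hne s hs
    have h4 : k - (s : ℂ) ≠ 0 := fun h => h3 (by linear_combination -h)
    have h5 : -1 / (k + (k₀ : ℂ)) / ((k - (s : ℂ)) / (k + (k₀ : ℂ))) = ((s : ℂ) - k)⁻¹ := by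
      rw [div_div_div_cancel_right₀ hne0, inv_eq_one_div, div_eq_div_iff h4 h3]
      ring
    rw [h5] at h2
    exact h2
  · apply ContinuousOn.intervalIntegrable
    rw [hI]
    exact ContinuousOn.inv₀ (by fun_prop) hne
end

section
/- Let k₀ ≥ 0 and define the phase Φ(k) = 32 i k⁵ − 160 i k₀⁴ k (i.e. Φ(k) = 32 i k⁵ − 2 i (x/t) k with x/t = 80 k₀⁴). Then for every k of the form k = k₀ + u + i v with v ≥ 0 and u ≥ √3 · v, one has Re Φ(k) = 32 v ( 10 u² v² + 20 u v² k₀ + 10 k₀² v² − 5 u⁴ − 20 u³ k₀ − 20 u k₀³ − 30 u² k₀² − v⁴ ) and Re Φ(k) ≤ −640 k₀³ u v. -/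
/-- Sign structure of the phase `Φ(k) = 32ik⁵ − 160ik₀⁴k` in the sector
`{k₀ + u + iv : u ≥ √3 v ≥ 0}` adjacent to the stationary point `k₀`:
the exact formula for `Re Φ(k)` and the bound `Re Φ(k) ≤ −640 k₀³ u v`. -/
theorem rePhi_sector_bound (k₀ u v : ℝ) (hk₀ : 0 ≤ k₀) (hv : 0 ≤ v)
    (huv : Real.sqrt 3 * v ≤ u) (k : ℂ)
    (hk : k = (k₀ : ℂ) + (u : ℂ) + (v : ℂ) * Complex.I) :
    (32 * Complex.I * k ^ 5 - 160 * Complex.I * (k₀ : ℂ) ^ 4 * k).re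
        = 32 * v * (10 * u ^ 2 * v ^ 2 + 20 * u * v ^ 2 * k₀ + 10 * k₀ ^ 2 * v ^ 2
            - 5 * u ^ 4 - 20 * u ^ 3 * k₀ - 20 * u * k₀ ^ 3 - 30 * u ^ 2 * k₀ ^ 2 - v ^ 4) ∧
    (32 * Complex.I * k ^ 5 - 160 * Complex.I * (k₀ : ℂ) ^ 4 * k).re
        ≤ -640 * k₀ ^ 3 * u * v := by
  have hre : (32 * Complex.I * k ^ 5 - 160 * Complex.I * (k₀ : ℂ) ^ 4 * k).re
        = 32 * v * (10 * u ^ 2 * v ^ 2 + 20 * u * v ^ 2 * k₀ + 10 * k₀ ^ 2 * v ^ 2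
            - 5 * u ^ 4 - 20 * u ^ 3 * k₀ - 20 * u * k₀ ^ 3 - 30 * u ^ 2 * k₀ ^ 2 - v ^ 4) := by
    subst hk
    rw [← Complex.ofReal_pow]
    simp [pow_succ, Complex.mul_re, Complex.mul_im]
    ring
  refine ⟨hre, ?_⟩
  rw [hre]
  have hu : 0 ≤ u := le_trans (by positivity) huv
  have hd : 0 ≤ u ^ 2 - 3 * v ^ 2 := by
    have h := pow_le_pow_left₀ (by positivity) huv 2
    rw [mul_pow, Real.sq_sqrt (by norm_num)] at h
    linarith
  have hd1 : 0 ≤ u ^ 2 - v ^ 2 := by nlinarith [sq_nonneg v]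
  have hd2 : 0 ≤ 3 * u ^ 2 - v ^ 2 := by nlinarith [sq_nonneg v]
  have key : 0 ≤ 32 * v * (5 * u ^ 2 * (u ^ 2 - 3 * v ^ 2) + 5 * u ^ 2 * v ^ 2
      + 20 * u * k₀ * (u ^ 2 - v ^ 2) + 10 * k₀ ^ 2 * (3 * u ^ 2 - v ^ 2) + v ^ 4) := by
    positivity
  nlinarith [key]
end

section
/- Let z₀ ≥ 0 and set y = 4 z₀⁴. Then for every s of the form s = z₀ + u + i v with v ≥ 0 and u ≥ √3 · v, one has Re( 2 i ( (4/5) s⁵ − y s ) ) = (8/5) v ( 10 u² v² + 20 u v² z₀ + 10 v² z₀² − 5 u⁴ − 20 u³ z₀ − 20 u z₀³ − 30 u² z₀² − v⁴ ) ≤ −2 u⁴ v. -/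
/-- Sign structure of the rescaled phase `2i((4/5)s⁵ − ys)` with `y = 4z₀⁴` in the sector
`{z₀ + u + iv : u ≥ √3 v ≥ 0}`: the exact formula for the real part and the bound `≤ −2u⁴v`. -/
theorem rePhase_painleve_sector_bound (z₀ u v : ℝ) (hz₀ : 0 ≤ z₀) (hv : 0 ≤ v)
    (huv : Real.sqrt 3 * v ≤ u) (s : ℂ)
    (hs : s = (z₀ : ℂ) + (u : ℂ) + (v : ℂ) * Complex.I) :
    (2 * Complex.I * ((4 / 5 : ℂ) * s ^ 5 - ((4 * z₀ ^ 4 : ℝ) : ℂ) * s)).re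
        = (8 / 5) * v * (10 * u ^ 2 * v ^ 2 + 20 * u * v ^ 2 * z₀ + 10 * v ^ 2 * z₀ ^ 2
            - 5 * u ^ 4 - 20 * u ^ 3 * z₀ - 20 * u * z₀ ^ 3 - 30 * u ^ 2 * z₀ ^ 2 - v ^ 4) ∧
    (2 * Complex.I * ((4 / 5 : ℂ) * s ^ 5 - ((4 * z₀ ^ 4 : ℝ) : ℂ) * s)).re
        ≤ -2 * u ^ 4 * v := by
  have key : (2 * Complex.I * ((4 / 5 : ℂ) * s ^ 5 - ((4 * z₀ ^ 4 : ℝ) : ℂ) * s)).re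
        = (8 / 5) * v * (10 * u ^ 2 * v ^ 2 + 20 * u * v ^ 2 * z₀ + 10 * v ^ 2 * z₀ ^ 2
            - 5 * u ^ 4 - 20 * u ^ 3 * z₀ - 20 * u * z₀ ^ 3 - 30 * u ^ 2 * z₀ ^ 2 - v ^ 4) := by
    have e : (4 / 5 : ℂ) = ((4 / 5 : ℝ) : ℂ) := by push_cast; rfl
    have hre : s.re = z₀ + u := by simp [hs]
    have him : s.im = v := by simp [hs]
    rw [e]
    simp only [pow_succ, pow_zero, one_mul, Complex.mul_re, Complex.mul_im, Complex.sub_re,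
      Complex.sub_im, Complex.ofReal_re, Complex.ofReal_im, Complex.I_re, Complex.I_im,
      Complex.re_ofNat, Complex.im_ofNat, hre, him]
    ring
  refine ⟨key, ?_⟩
  rw [key]
  have hu : 0 ≤ u := le_trans (by positivity) huv
  have hw : 3 * v ^ 2 ≤ u ^ 2 := by
    have h := pow_le_pow_left₀ (by positivity) huv 2
    rwa [mul_pow, Real.sq_sqrt (by norm_num)] at h
  have h1 := mul_le_mul_of_nonneg_left hw (sq_nonneg u)
  have h2 := mul_le_mul_of_nonneg_left hw (mul_nonneg hu hz₀)
  have h3 := mul_le_mul_of_nonneg_left hw (sq_nonneg z₀)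
  have p1 : 0 ≤ u ^ 4 := by positivity
  have p2 : 0 ≤ u ^ 3 * z₀ := by positivity
  have p3 : 0 ≤ u * z₀ ^ 3 := by positivity
  have p4 : 0 ≤ u ^ 2 * z₀ ^ 2 := by positivity
  have p5 : 0 ≤ v ^ 4 := by positivity
  have h : 10 * u ^ 2 * v ^ 2 + 20 * u * v ^ 2 * z₀ + 10 * v ^ 2 * z₀ ^ 2
            - 5 * u ^ 4 - 20 * u ^ 3 * z₀ - 20 * u * z₀ ^ 3 - 30 * u ^ 2 * z₀ ^ 2 - v ^ 4
            ≤ -(5 / 4) * u ^ 4 := by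
    linarith
  have := mul_le_mul_of_nonneg_left h (show 0 ≤ 8 / 5 * v by positivity)
  linarith
end

section
/- Let z₀ ≥ 0, l ≥ 0 and set y = 4 z₀⁴. Then for z = z₀ + l e^{iπ/6}, and likewise for z = −z₀ + l e^{5iπ/6}, one has the exact identity Re( 2 i ( (4/5) z⁵ − y z ) ) = l² ( −(4/5) l³ − 4√3 z₀ l² − 16 z₀² l − 8√3 z₀³ ). In particular this quantity is ≤ 0, with strict decay for l > 0 and z₀ > 0. -/
lemma re_aux (a b Y : ℝ) (z : ℂ) (hz : z = (a : ℂ) + (b : ℂ) * Complex.I) :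
    (2 * Complex.I * ((4 / 5 : ℂ) * z ^ 5 - (Y : ℂ) * z)).re
      = -2 * (4 / 5 * (5 * a ^ 4 * b - 10 * a ^ 2 * b ^ 3 + b ^ 5) - Y * b) := by
  have h : 2 * Complex.I * ((4 / 5 : ℂ) * z ^ 5 - (Y : ℂ) * z)
      = ((-2 * (4 / 5 * (5 * a ^ 4 * b - 10 * a ^ 2 * b ^ 3 + b ^ 5) - Y * b) : ℝ) : ℂ)
        + ((2 * (4 / 5 * (a ^ 5 - 10 * a ^ 3 * b ^ 2 + 5 * a * b ^ 4) - Y * a) : ℝ) : ℂ)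
          * Complex.I := by
    have h2 : Complex.I ^ 2 = -1 := Complex.I_sq
    have h3 : Complex.I ^ 3 = -Complex.I := by rw [pow_succ, h2]; ring
    have h4 : Complex.I ^ 4 = 1 := Complex.I_pow_four
    have h5 : Complex.I ^ 5 = Complex.I := by rw [pow_succ, h4]; ring
    have h6 : Complex.I ^ 6 = -1 := by rw [pow_succ, h5, ← sq, h2]
    rw [hz]
    push_cast
    ring_nf
    simp only [h2, h3, h4, h5, h6]
    ring
  rw [h, Complex.add_re, Complex.re_ofReal_mul, Complex.ofReal_re, Complex.I_re, mul_zero, add_zero]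

/-- On the rays `z = z₀ + l e^{iπ/6}` and `z = −z₀ + l e^{5iπ/6}` (with `y = 4z₀⁴`),
the exact identity
`Re(2i((4/5)z⁵ − yz)) = l²(−(4/5)l³ − 4√3 z₀ l² − 16 z₀² l − 8√3 z₀³)` holds;
in particular this quantity is `≤ 0`, and `< 0` when `l > 0` and `z₀ > 0`. -/
theorem rePhase_on_contour_rays (z₀ l : ℝ) (hz₀ : 0 ≤ z₀) (hl : 0 ≤ l) :
    (2 * Complex.I * ((4 / 5 : ℂ) * ((z₀ : ℂ) + (l : ℂ) * Complex.exp (((Real.pi / 6 : ℝ) : ℂ) * Complex.I)) ^ 5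
        - ((4 * z₀ ^ 4 : ℝ) : ℂ) * ((z₀ : ℂ) + (l : ℂ) * Complex.exp (((Real.pi / 6 : ℝ) : ℂ) * Complex.I)))).re
      = l ^ 2 * (-(4 / 5) * l ^ 3 - 4 * Real.sqrt 3 * z₀ * l ^ 2 - 16 * z₀ ^ 2 * l
          - 8 * Real.sqrt 3 * z₀ ^ 3) ∧
    (2 * Complex.I * ((4 / 5 : ℂ) * (-(z₀ : ℂ) + (l : ℂ) * Complex.exp (((5 * Real.pi / 6 : ℝ) : ℂ) * Complex.I)) ^ 5
        - ((4 * z₀ ^ 4 : ℝ) : ℂ) * (-(z₀ : ℂ) + (l : ℂ) * Complex.exp (((5 * Real.pi / 6 : ℝ) : ℂ) * Complex.I)))).re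
      = l ^ 2 * (-(4 / 5) * l ^ 3 - 4 * Real.sqrt 3 * z₀ * l ^ 2 - 16 * z₀ ^ 2 * l
          - 8 * Real.sqrt 3 * z₀ ^ 3) ∧
    l ^ 2 * (-(4 / 5) * l ^ 3 - 4 * Real.sqrt 3 * z₀ * l ^ 2 - 16 * z₀ ^ 2 * l
          - 8 * Real.sqrt 3 * z₀ ^ 3) ≤ 0 ∧
    (0 < l → 0 < z₀ →
      l ^ 2 * (-(4 / 5) * l ^ 3 - 4 * Real.sqrt 3 * z₀ * l ^ 2 - 16 * z₀ ^ 2 * l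
          - 8 * Real.sqrt 3 * z₀ ^ 3) < 0) := by
  have s2 : Real.sqrt 3 ^ 2 = 3 := Real.sq_sqrt (by norm_num)
  have s3 : Real.sqrt 3 ^ 3 = 3 * Real.sqrt 3 := by rw [pow_succ, s2]
  have s4 : Real.sqrt 3 ^ 4 = 9 := by rw [pow_succ, s3, mul_assoc, ← sq, s2]; norm_num
  have e5 : 5 * Real.pi / 6 = Real.pi - Real.pi / 6 := by ring
  refine ⟨?_, ?_, ?_, ?_⟩
  · rw [re_aux (z₀ + l * (Real.sqrt 3 / 2)) (l / 2)]
    · ring_nf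
      simp only [s2, s3, s4]
      ring
    · rw [Complex.exp_mul_I, ← Complex.ofReal_cos, ← Complex.ofReal_sin, Real.cos_pi_div_six,
        Real.sin_pi_div_six]
      push_cast
      ring
  · rw [re_aux (-z₀ - l * (Real.sqrt 3 / 2)) (l / 2)]
    · ring_nf
      simp only [s2, s3, s4]
      ring
    · rw [Complex.exp_mul_I, ← Complex.ofReal_cos, ← Complex.ofReal_sin, e5, Real.cos_pi_sub,
        Real.sin_pi_sub, Real.cos_pi_div_six, Real.sin_pi_div_six]
      push_cast
      ring
  · have h : 0 ≤ l ^ 2 * (4 / 5 * l ^ 3 + 4 * Real.sqrt 3 * z₀ * l ^ 2 + 16 * z₀ ^ 2 * l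
          + 8 * Real.sqrt 3 * z₀ ^ 3) := by positivity
    linarith
  · intro hl' hz'
    have h : 0 < l ^ 2 * (4 / 5 * l ^ 3 + 4 * Real.sqrt 3 * z₀ * l ^ 2 + 16 * z₀ ^ 2 * l
          + 8 * Real.sqrt 3 * z₀ ^ 3) := by positivity
    linarith
end

section
/- Let τ > 0 and ρ ≥ 0, and set y = −4 (20τ)^{4/5} (so y ≤ 0). Then for every s of the form s = u + i (v + ρ) with v ≥ 0 and u ≥ √3 · (v + ρ), one has Re( 2 i ( (4/5) s⁵ − y s ) ) = (8/5) (v+ρ) ( 10 u² (v+ρ)² − 5 u⁴ − (v+ρ)⁴ ) + 2 y (v+ρ) ≤ −u⁴ v − 8 (20τ)^{4/5} ρ. -/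
/-- Sign structure of the phase `2i((4/5)s⁵ − ys)` with `y = −4(20τ)^{4/5}` in the region
`{u + i(v+ρ) : v ≥ 0, u ≥ √3(v+ρ)}` above the horizontal line `Im z = ρ` (Region IV):
the exact formula for the real part and the bound `≤ −u⁴v − 8(20τ)^{4/5}ρ`. -/
theorem rePhase_regionIV_bound (τ ρ u v : ℝ) (hτ : 0 < τ) (hρ : 0 ≤ ρ) (hv : 0 ≤ v)
    (huv : Real.sqrt 3 * (v + ρ) ≤ u) (y : ℝ) (hy : y = -4 * (20 * τ) ^ ((4 : ℝ) / 5))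
    (s : ℂ) (hs : s = (u : ℂ) + ((v + ρ : ℝ) : ℂ) * Complex.I) :
    (2 * Complex.I * ((4 / 5 : ℂ) * s ^ 5 - (y : ℂ) * s)).re
        = (8 / 5) * (v + ρ) * (10 * u ^ 2 * (v + ρ) ^ 2 - 5 * u ^ 4 - (v + ρ) ^ 4)
            + 2 * y * (v + ρ) ∧
    (2 * Complex.I * ((4 / 5 : ℂ) * s ^ 5 - (y : ℂ) * s)).re
        ≤ -(u ^ 4 * v) - 8 * (20 * τ) ^ ((4 : ℝ) / 5) * ρ := by
  have key : (2 * Complex.I * ((4 / 5 : ℂ) * s ^ 5 - (y : ℂ) * s)).re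
        = (8 / 5) * (v + ρ) * (10 * u ^ 2 * (v + ρ) ^ 2 - 5 * u ^ 4 - (v + ρ) ^ 4)
            + 2 * y * (v + ρ) := by
    have hc : (4 / 5 : ℂ) = ((4 / 5 : ℝ) : ℂ) := by push_cast; rfl
    have h2 : (2 : ℂ) = ((2 : ℝ) : ℂ) := by push_cast; rfl
    have hre : s.re = u := by rw [hs]; simp
    have him : s.im = v + ρ := by rw [hs]; simp
    rw [hc, h2]
    simp only [pow_succ, pow_zero, one_mul, Complex.mul_re, Complex.mul_im, Complex.sub_re,
      Complex.sub_im, Complex.ofReal_re, Complex.ofReal_im, Complex.I_re, Complex.I_im, hre, him]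
    ring
  refine ⟨key, ?_⟩
  rw [key, hy]
  have hY : 0 ≤ (20 * τ) ^ ((4 : ℝ) / 5) := by positivity
  generalize (20 * τ) ^ ((4 : ℝ) / 5) = Y at hY
  have hw : 0 ≤ v + ρ := by positivity
  have hsq : 3 * (v + ρ) ^ 2 ≤ u ^ 2 := by
    have h := pow_le_pow_left₀ (by positivity) huv 2
    rwa [mul_pow, Real.sq_sqrt (by norm_num)] at h
  have h1 : 10 * u ^ 2 * (v + ρ) ^ 2 - 5 * u ^ 4 - (v + ρ) ^ 4 ≤ -(5 / 3) * u ^ 4 := by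
    nlinarith [mul_le_mul_of_nonneg_left hsq (sq_nonneg u), sq_nonneg ((v + ρ) ^ 2)]
  have h2 := mul_le_mul_of_nonneg_left h1 hw
  have h3 : 0 ≤ u ^ 4 * v := by positivity
  have h4 : 0 ≤ u ^ 4 * ρ := by positivity
  have h5 : 0 ≤ Y * v := by positivity
  nlinarith
end

section
/- Let τ > 0. Then for every z of the form z = 1 + u + i v with v ≥ 0 and u ≥ √3 · v, one has Re( 32 i τ ( z⁵ − 5 z ) ) = 32 τ v ( 10 u² v² + 20 u v² + 10 v² − 5 u⁴ − 20 u³ − 30 u² − 20 u − v⁴ ) ≤ −2 τ u⁴ v. -/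
/-- Sign structure of the rescaled phase `32iτ(z⁵ − 5z)` in the sector
`{1 + u + iv : u ≥ √3 v ≥ 0}` to the right of the rescaled stationary point `z = 1`
(Region II): the exact formula for the real part and the bound `≤ −2τu⁴v`. -/
theorem rePhase_regionII_bound (τ u v : ℝ) (hτ : 0 < τ) (hv : 0 ≤ v)
    (huv : Real.sqrt 3 * v ≤ u) (z : ℂ)
    (hz : z = 1 + (u : ℂ) + (v : ℂ) * Complex.I) :
    (32 * Complex.I * (τ : ℂ) * (z ^ 5 - 5 * z)).re
        = 32 * τ * v * (10 * u ^ 2 * v ^ 2 + 20 * u * v ^ 2 + 10 * v ^ 2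
            - 5 * u ^ 4 - 20 * u ^ 3 - 30 * u ^ 2 - 20 * u - v ^ 4) ∧
    (32 * Complex.I * (τ : ℂ) * (z ^ 5 - 5 * z)).re ≤ -2 * τ * u ^ 4 * v := by
  have key : (32 * Complex.I * (τ : ℂ) * (z ^ 5 - 5 * z)).re
        = 32 * τ * v * (10 * u ^ 2 * v ^ 2 + 20 * u * v ^ 2 + 10 * v ^ 2
            - 5 * u ^ 4 - 20 * u ^ 3 - 30 * u ^ 2 - 20 * u - v ^ 4) := by
    subst hz
    simp only [pow_succ, pow_zero, one_mul, Complex.mul_re, Complex.mul_im, Complex.add_re,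
      Complex.add_im, Complex.sub_re, Complex.sub_im, Complex.I_re, Complex.I_im,
      Complex.ofReal_re, Complex.ofReal_im, Complex.one_re, Complex.one_im,
      Complex.re_ofNat, Complex.im_ofNat]
    ring
  refine ⟨key, ?_⟩
  rw [key]
  have hs : 0 ≤ Real.sqrt 3 := Real.sqrt_nonneg 3
  have hu : 0 ≤ u := le_trans (mul_nonneg hs hv) huv
  have h3 : 3 * v ^ 2 ≤ u ^ 2 := by
    have h := pow_le_pow_left₀ (mul_nonneg hs hv) huv 2
    rw [mul_pow, Real.sq_sqrt (by norm_num)] at h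
    exact h
  have hP : 10 * u ^ 2 * v ^ 2 + 20 * u * v ^ 2 + 10 * v ^ 2
            - 5 * u ^ 4 - 20 * u ^ 3 - 30 * u ^ 2 - 20 * u - v ^ 4 ≤ - u ^ 4 / 16 := by
    have h1 := mul_le_mul_of_nonneg_left h3 (sq_nonneg u)
    have h2 := mul_le_mul_of_nonneg_left h3 hu
    have h4 : 0 ≤ u ^ 4 := by positivity
    have h5 : 0 ≤ u ^ 3 := by positivity
    have h6 : 0 ≤ u ^ 2 := by positivity
    have h7 : 0 ≤ v ^ 4 := by positivity
    nlinarith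
  have hm : 0 ≤ 32 * τ * v := by positivity
  have := mul_le_mul_of_nonneg_left hP hm
  linarith
end

section
/- The double integral ∫₀^∞ ∫_{√3 v}^∞ (u² + v²)^{−1/4} e^{−2 u⁴ v} du dv is finite; that is, there exists C > 0 with ∫₀^∞ ∫_{√3 v}^∞ (u² + v²)^{−1/4} e^{−2 u⁴ v} du dv ≤ C. -/
open MeasureTheory

noncomputable def pwG (a b : ℝ) (x : ℝ) : ℝ := if x ≤ 1 then x ^ a else x ^ b

lemma pwG_nonneg (a b x : ℝ) (hx : 0 < x) : 0 ≤ pwG a b x := by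
  unfold pwG; split_ifs <;> positivity

lemma pwG_fin (a b : ℝ) (ha : -1 < a) (hb : b < -1) :
    (∫⁻ x in Set.Ioi (0 : ℝ), ENNReal.ofReal (pwG a b x)) < ⊤ := by
  have h1 : IntegrableOn (fun x : ℝ => x ^ a) (Set.Ioc 0 1) :=
    (intervalIntegrable_iff_integrableOn_Ioc_of_le zero_le_one).1
      (intervalIntegral.intervalIntegrable_rpow' ha)
  have h2 : IntegrableOn (fun x : ℝ => x ^ b) (Set.Ioi 1) :=
    integrableOn_Ioi_rpow_of_lt hb one_pos
  have h1' : IntegrableOn (pwG a b) (Set.Ioc 0 1) :=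
    h1.congr_fun (fun x hx => by simp [pwG, hx.2]) measurableSet_Ioc
  have h2' : IntegrableOn (pwG a b) (Set.Ioi 1) :=
    h2.congr_fun (fun x hx => by simp [pwG, not_le.2 (Set.mem_Ioi.1 hx)]) measurableSet_Ioi
  have h := h1'.union h2'
  rw [Set.Ioc_union_Ioi_eq_Ioi zero_le_one] at h
  exact Integrable.lintegral_lt_top h

lemma pw_bound (u v : ℝ) (hv : 0 < v) (hu : Real.sqrt 3 * v < u) :
    (u ^ 2 + v ^ 2) ^ (-(1 : ℝ) / 4) * Real.exp (-2 * u ^ 4 * v) ≤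
      pwG (-1/2) (-5/2) u * pwG (-1/2) (-2) v := by
  have h3 : (1:ℝ) ≤ Real.sqrt 3 := Real.one_le_sqrt.2 (by norm_num)
  have hvu : v < u := by nlinarith
  have hu0 : 0 < u := hv.trans hvu
  have hA : (u ^ 2 + v ^ 2) ^ (-(1 : ℝ) / 4) ≤ u ^ (-1/2 : ℝ) := by
    calc (u ^ 2 + v ^ 2) ^ (-(1 : ℝ) / 4) ≤ (u ^ 2) ^ (-(1 : ℝ) / 4) :=
          Real.rpow_le_rpow_of_nonpos (by positivity) (by nlinarith [sq_nonneg v]) (by norm_num)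
      _ = u ^ (-1/2 : ℝ) := by
          rw [← Real.rpow_natCast, ← Real.rpow_mul hu0.le]; norm_num
  have hp : 0 ≤ u ^ (-1/2 : ℝ) := by positivity
  by_cases hu1 : u ≤ 1
  · have hv1 : v ≤ 1 := by linarith
    simp only [pwG, hu1, hv1, if_true]
    have hE : Real.exp (-2 * u ^ 4 * v) ≤ 1 := by
      rw [Real.exp_le_one_iff]
      have : 0 ≤ u ^ 4 * v := by positivity
      linarith
    have hV : 1 ≤ v ^ (-1/2 : ℝ) :=
      Real.one_le_rpow_of_pos_of_le_one_of_nonpos hv hv1 (by norm_num)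
    exact mul_le_mul hA (hE.trans hV) (Real.exp_pos _).le hp
  · have hu1' : 1 < u := not_le.1 hu1
    have hsplit : u ^ (-5/2 : ℝ) = u ^ (-1/2 : ℝ) * u ^ (-2 : ℝ) := by
      rw [← Real.rpow_add hu0]; norm_num
    have hu2 : u ^ (-2 : ℝ) = (u ^ 2)⁻¹ := by
      rw [Real.rpow_neg hu0.le]; norm_num
    by_cases hv1 : v ≤ 1
    · simp only [pwG, hu1, hv1, if_true, if_false]
      rw [hsplit, mul_assoc (u ^ (-1/2 : ℝ))]
      refine mul_le_mul hA ?_ (Real.exp_pos _).le hp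
      have hs : v ^ (-1/2 : ℝ) = (Real.sqrt v)⁻¹ := by
        rw [Real.sqrt_eq_rpow, ← Real.rpow_neg hv.le]; norm_num
      rw [hu2, hs, ← mul_inv, show -2 * u ^ 4 * v = -(2 * u ^ 4 * v) by ring, Real.exp_neg]
      have hsv := Real.sq_sqrt hv.le
      have hsp := Real.sqrt_pos.2 hv
      apply inv_anti₀ (by positivity)
      have := Real.add_one_le_exp (2 * u ^ 4 * v)
      have e : u ^ 4 * v = (u ^ 2 * Real.sqrt v) ^ 2 := by rw [mul_pow, hsv]; ring
      nlinarith [sq_nonneg (u ^ 2 * Real.sqrt v - 1), sq_nonneg (u ^ 2 * Real.sqrt v)]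
    · have hv1' : 1 < v := not_le.1 hv1
      simp only [pwG, hu1, hv1, if_false]
      rw [hsplit, mul_assoc (u ^ (-1/2 : ℝ))]
      refine mul_le_mul hA ?_ (Real.exp_pos _).le hp
      have hs : v ^ (-2 : ℝ) = (v ^ 2)⁻¹ := by
        rw [Real.rpow_neg hv.le]; norm_num
      rw [hu2, hs, ← mul_inv, show -2 * u ^ 4 * v = -(2 * u ^ 4 * v) by ring, Real.exp_neg]
      apply inv_anti₀ (by positivity)
      have hq := Real.quadratic_le_exp_of_nonneg (x := 2 * u ^ 4 * v) (by positivity)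
      have h0 : 0 < 2 * u ^ 4 * v := by positivity
      have h8 : u ^ 2 ≤ u ^ 8 := pow_le_pow_right₀ hu1'.le (by norm_num)
      have h9 : u ^ 2 * v ^ 2 ≤ u ^ 8 * v ^ 2 := by gcongr
      have h10 : 0 ≤ u ^ 8 * v ^ 2 := by positivity
      nlinarith

/-- The double integral `∫₀^∞ ∫_{√3 v}^∞ (u² + v²)^{−1/4} e^{−2u⁴v} du dv` is finite:
there is a constant `C > 0` bounding it. -/
theorem dbar_singular_double_integral_bound :
    ∃ C : ℝ, 0 < C ∧
      (∫⁻ v in Set.Ioi (0 : ℝ), ∫⁻ u in Set.Ioi (Real.sqrt 3 * v),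
          ENNReal.ofReal ((u ^ 2 + v ^ 2) ^ (-(1 : ℝ) / 4) * Real.exp (-2 * u ^ 4 * v)))
        ≤ ENNReal.ofReal C := by
  have hG := pwG_fin (-1/2) (-5/2) (by norm_num) (by norm_num)
  have hH := pwG_fin (-1/2) (-2) (by norm_num) (by norm_num)
  set A := ∫⁻ x in Set.Ioi (0 : ℝ), ENNReal.ofReal (pwG (-1/2) (-5/2) x) with hAdef
  set B := ∫⁻ x in Set.Ioi (0 : ℝ), ENNReal.ofReal (pwG (-1/2) (-2) x) with hBdef
  have key : (∫⁻ v in Set.Ioi (0 : ℝ), ∫⁻ u in Set.Ioi (Real.sqrt 3 * v),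
          ENNReal.ofReal ((u ^ 2 + v ^ 2) ^ (-(1 : ℝ) / 4) * Real.exp (-2 * u ^ 4 * v)))
        ≤ A * B := by
    rw [hBdef, ← lintegral_const_mul' _ _ hG.ne]
    refine setLIntegral_mono' measurableSet_Ioi fun v hv => ?_
    have hv : 0 < v := hv
    rw [hAdef, ← lintegral_mul_const' _ _ ENNReal.ofReal_ne_top]
    have hs : 0 ≤ Real.sqrt 3 * v := by positivity
    refine le_trans (setLIntegral_mono' measurableSet_Ioi fun u hu => ?_)
      (lintegral_mono_set (Set.Ioi_subset_Ioi hs))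
    have hu : Real.sqrt 3 * v < u := hu
    rw [← ENNReal.ofReal_mul (pwG_nonneg _ _ _ (hs.trans_lt hu))]
    exact ENNReal.ofReal_le_ofReal (pw_bound u v hv hu)
  have hfin : A * B ≠ ⊤ := ENNReal.mul_ne_top hG.ne hH.ne
  refine ⟨(A * B).toReal + 1, by positivity, key.trans ?_⟩
  rw [ENNReal.le_ofReal_iff_toReal_le hfin (by positivity)]
  linarith
end
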